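/- For every Young diagram λ, the normalized character on a 4-cycle satisfies Σ_4^λ = R_5^λ + 5·R_3^λ (i.e., the Kerov polynomial K_4 equals R_5 + 5R_3). -/

import Mathlib

open scoped BigOperators

namespace AsympRep

/-- A fixed filling: the canonical bijection between `Fin μ.card` and the cells of `μ`. -/
noncomputable def fill (μ : YoungDiagram) : Fin μ.card ≃ {c // c ∈ μ.cells} :=
  (Fintype.equivFinOfCardEq (Fintype.card_coe _)).symm

/-- Row coordinate of the box occupied by `x` in the canonical filling. -/
noncomputable def rowOf (μ : YoungDiagram) (x : Fin μ.card) : ℕ := (fill μ x).1.1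

/-- Column coordinate of the box occupied by `x` in the canonical filling. -/
noncomputable def colOf (μ : YoungDiagram) (x : Fin μ.card) : ℕ := (fill μ x).1.2

/-- The Young symmetrizer `c_μ = a_μ * b_μ` in the group algebra `ℚ[S_n]`, `n = |μ|`,
where `a_μ` is the sum of the row-preserving permutations and `b_μ` is the signed sum
of the column-preserving permutations (for the canonical filling of `μ`). -/
noncomputable def youngSymmetrizer (μ : YoungDiagram) :
    MonoidAlgebra ℚ (Equiv.Perm (Fin μ.card)) :=
  (∑ g : Equiv.Perm (Fin μ.card),
      if ∀ x, rowOf μ (g x) = rowOf μ x then MonoidAlgebra.single g (1 : ℚ) else 0) *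
  (∑ g : Equiv.Perm (Fin μ.card),
      if ∀ x, colOf μ (g x) = colOf μ x
      then MonoidAlgebra.single g ((Equiv.Perm.sign g : ℤ) : ℚ) else 0)

/-- The Specht module: the left ideal `ℚ[S_n]·c_μ`, realizing the irreducible
representation `ρ^μ` of `S_n` (by left multiplication). -/
noncomputable def spechtModule (μ : YoungDiagram) :
    Submodule ℚ (MonoidAlgebra ℚ (Equiv.Perm (Fin μ.card))) :=
  LinearMap.range (LinearMap.mulRight ℚ (youngSymmetrizer μ))

theorem spechtModule_invariant (μ : YoungDiagram) (π : Equiv.Perm (Fin μ.card)) :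
    ∀ x ∈ spechtModule μ,
      (LinearMap.mulLeft ℚ (MonoidAlgebra.single π (1 : ℚ))) x ∈ spechtModule μ := by
  rintro x ⟨y, rfl⟩
  exact ⟨MonoidAlgebra.single π (1 : ℚ) * y, by
    simp only [LinearMap.mulRight_apply, LinearMap.mulLeft_apply, mul_assoc]⟩

/-- The irreducible character `χ^μ(π) = Tr ρ^μ(π)` of the symmetric group `S_n`,
`n = |μ|`, computed as the trace of left multiplication by `π` on the Specht module. -/
noncomputable def irrChar (μ : YoungDiagram) (π : Equiv.Perm (Fin μ.card)) : ℚ :=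
  LinearMap.trace ℚ (spechtModule μ)
    ((LinearMap.mulLeft ℚ (MonoidAlgebra.single π (1 : ℚ))).restrict
      (spechtModule_invariant μ π))

/-- The normalized character
`Σ_π^μ = n(n-1)⋯(n-k+1) · Tr ρ^μ(π) / Tr ρ^μ(e)` for `π ∈ S_k`, where `π` is regarded
as a permutation of `{1,…,n}` acting as the identity on `{k+1,…,n}`; it is `0` if `k > n`. -/
noncomputable def normChar {k : ℕ} (μ : YoungDiagram) (π : Equiv.Perm (Fin k)) : ℚ :=
  if h : k ≤ μ.card then
    (μ.card.descFactorial k : ℚ)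
      * irrChar μ (π.viaEmbedding (Fin.castLEEmb h)) / irrChar μ 1
  else 0

/-- `Σ_m^μ`: the normalized character on the `m`-cycle `(1,2,…,m) ∈ S_m`. -/
noncomputable def SigmaCycle (μ : YoungDiagram) (m : ℕ) : ℚ := normChar μ (finRotate m)

/-- The dilation `sμ` of a Young diagram: every box is replaced by an `s × s` grid
of boxes. -/
def dilate (μ : YoungDiagram) (s : ℕ) : YoungDiagram where
  cells := (Finset.range (s * μ.colLen 0) ×ˢ Finset.range (s * μ.rowLen 0)).filter
      (fun c => (c.1 / s, c.2 / s) ∈ μ.cells)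
  isLowerSet := by
    intro a b hba h
    simp only [Finset.coe_filter, Set.mem_setOf_eq, Finset.mem_product,
      Finset.mem_range] at h ⊢
    exact ⟨⟨lt_of_le_of_lt hba.1 h.1.1, lt_of_le_of_lt hba.2 h.1.2⟩,
      μ.isLowerSet (Prod.mk_le_mk.mpr
        ⟨Nat.div_le_div_right hba.1, Nat.div_le_div_right hba.2⟩) h.2⟩

open scoped Classical in
/-- The `k`-th free cumulant `R_k^μ`: the coefficient of `s^k` in the polynomial
`s ↦ Σ_{k-1}^{sμ}`. -/
noncomputable def freeCumulant (μ : YoungDiagram) (k : ℕ) : ℚ :=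
  if h : ∃ p : Polynomial ℚ, ∀ s : ℕ, 0 < s →
      SigmaCycle (dilate μ s) (k - 1) = Polynomial.eval (s : ℚ) p
  then h.choose.coeff k else 0

/-- `N^μ(σ₁,σ₂)`: the number of colorings of the cycles of `σ₁` (by column numbers)
and of the cycles of `σ₂` (by row numbers) compatible with `μ`.  A coloring of the
cycles is encoded as a pair of functions on points constant on the respective cycles;
compatibility means that for every point `a` the box in column `h₁(a)` and row `h₂(a)`
belongs to `μ` (two cycles intersect precisely when they share a point). -/
noncomputable def Ncolorings {k : ℕ} (μ : YoungDiagram) (σ₁ σ₂ : Equiv.Perm (Fin k)) : ℕ :=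
  Set.ncard {h : (Fin k → ℕ) × (Fin k → ℕ) |
    (∀ a, h.1 (σ₁ a) = h.1 a) ∧ (∀ a, h.2 (σ₂ a) = h.2 a) ∧
    ∀ a, (h.2 a, h.1 a) ∈ μ.cells }

/-- `|C(σ)|`: the number of cycles of a permutation (fixed points count as cycles),
i.e. the number of orbits. -/
noncomputable def numCycles {k : ℕ} (σ : Equiv.Perm (Fin k)) : ℕ :=
  Set.ncard {s : Set (Fin k) | ∃ a, s = {b | σ.SameCycle a b}}

/-- The region of the plane occupied by the Young diagram `μ` drawn in the French
convention (row `i` of the diagram, `0`-indexed, occupies `[0, μ_i] × [i, i+1]`). -/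
def frenchRegion (μ : YoungDiagram) : Set (ℝ × ℝ) :=
  {p | 0 ≤ p.1 ∧ 0 ≤ p.2 ∧ p.1 ≤ (μ.rowLen ⌊p.2⌋.toNat : ℝ)}

/-- The parameter `S_i^μ = (i-1) ∬_{(x,y)∈μ} (x-y)^{i-2} dx dy` (French convention). -/
noncomputable def Sparam (μ : YoungDiagram) (i : ℕ) : ℝ :=
  ((i : ℝ) - 1) * ∫ p in frenchRegion μ, (p.1 - p.2) ^ (i - 2)

/-- The profile `ω : ℝ → ℝ` of a Young diagram: the boundary of the diagram drawn in
the Russian convention, i.e. the image of the French region under the rotation by `π/4`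
composed with the dilation by `√2`, `(x, y) ↦ (x - y, x + y)`.  `ω(u)` is the largest
`v` with `(u,v)` in the rotated region, and `ω(u) = |u|` away from the diagram. -/
noncomputable def profile (μ : YoungDiagram) (u : ℝ) : ℝ :=
  max |u| (sSup {v : ℝ | ((u + v) / 2, (v - u) / 2) ∈ frenchRegion μ})

/-- The permutation preserves every row of the canonical filling. -/
def RowStab (μ : YoungDiagram) (g : Equiv.Perm (Fin μ.card)) : Prop :=
  ∀ x, rowOf μ (g x) = rowOf μ x

/-- The permutation preserves every column of the canonical filling. -/
def ColStab (μ : YoungDiagram) (g : Equiv.Perm (Fin μ.card)) : Prop :=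
  ∀ x, colOf μ (g x) = colOf μ x

noncomputable instance (μ : YoungDiagram) : DecidablePred (RowStab μ) :=
  fun g => inferInstanceAs (Decidable (∀ x, rowOf μ (g x) = rowOf μ x))

noncomputable instance (μ : YoungDiagram) : DecidablePred (ColStab μ) :=
  fun g => inferInstanceAs (Decidable (∀ x, colOf μ (g x) = colOf μ x))

theorem box_injective {μ : YoungDiagram} {x y : Fin μ.card}
    (hr : rowOf μ x = rowOf μ y) (hc : colOf μ x = colOf μ y) : x = y :=
  (fill μ).injective (Subtype.ext (Prod.ext hr hc))

theorem RowStab.mul {μ : YoungDiagram} {g h : Equiv.Perm (Fin μ.card)}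
    (hg : RowStab μ g) (hh : RowStab μ h) : RowStab μ (g * h) :=
  fun x => (hg (h x)).trans (hh x)

theorem RowStab.inv {μ : YoungDiagram} {g : Equiv.Perm (Fin μ.card)}
    (hg : RowStab μ g) : RowStab μ g⁻¹ :=
  fun x => by simpa using (hg (g⁻¹ x)).symm

theorem ColStab.mul {μ : YoungDiagram} {g h : Equiv.Perm (Fin μ.card)}
    (hg : ColStab μ g) (hh : ColStab μ h) : ColStab μ (g * h) :=
  fun x => (hg (h x)).trans (hh x)

theorem ColStab.inv {μ : YoungDiagram} {g : Equiv.Perm (Fin μ.card)}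
    (hg : ColStab μ g) : ColStab μ g⁻¹ :=
  fun x => by simpa using (hg (g⁻¹ x)).symm

theorem RowStab.mul_left_iff {μ : YoungDiagram} {g h : Equiv.Perm (Fin μ.card)}
    (hg : RowStab μ g) : RowStab μ (g * h) ↔ RowStab μ h :=
  ⟨fun H => by simpa using hg.inv.mul H, hg.mul⟩

theorem ColStab.mul_right_iff {μ : YoungDiagram} {g h : Equiv.Perm (Fin μ.card)}
    (hg : ColStab μ g) : ColStab μ (h * g) ↔ ColStab μ h :=
  ⟨fun H => by simpa using H.mul hg.inv, fun H => H.mul hg⟩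

/-- If a family of boxes indexed by the boxes of `μ` is injective and has the row and column
lengths of `μ`, then it consists of boxes of `μ`. -/
theorem mem_cells_of_injective {μ : YoungDiagram} (g : Equiv.Perm (Fin μ.card))
    (hinj : Function.Injective fun x => (rowOf μ x, colOf μ (g x))) (x : Fin μ.card) :
    (rowOf μ x, colOf μ (g x)) ∈ μ.cells := by
  set f : Fin μ.card → ℕ × ℕ := fun x => (rowOf μ x, colOf μ (g x)) with hf
  let w : ℕ × ℕ → ℤ := fun c => 2 * c.2 - 2 * μ.rowLen c.1 + 1
  let A := Finset.univ.image f
  have hcells : μ.cells = Finset.univ.image fun x => (rowOf μ x, colOf μ x) := by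
    ext c
    simp only [Finset.mem_image, Finset.mem_univ, true_and]
    constructor
    · intro hc
      exact ⟨(fill μ).symm ⟨c, hc⟩, by simp [rowOf, colOf]⟩
    · rintro ⟨x, rfl⟩
      exact (fill μ x).2
  have hA : ∑ c ∈ A, w c = ∑ x, w (f x) := Finset.sum_image fun _ _ _ _ h => hinj h
  have hM : ∑ c ∈ μ.cells, w c = ∑ x, w (rowOf μ x, colOf μ x) := by
    rw [hcells]
    refine Finset.sum_image fun a _ b _ h => ?_
    simp only [Prod.mk.injEq] at h
    exact box_injective h.1 h.2
  have hsum : ∑ c ∈ A, w c = ∑ c ∈ μ.cells, w c := by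
    rw [hA, hM]
    simp only [hf, w, Finset.sum_add_distrib, Finset.sum_sub_distrib]
    congr 2
    exact Equiv.sum_comp g fun x => 2 * (colOf μ x : ℤ)
  have hsd : ∑ c ∈ A \ μ.cells, w c = ∑ c ∈ μ.cells \ A, w c := by
    have h1 := Finset.sum_sdiff_eq_sub (f := w) (Finset.inter_subset_left (s₁ := A) (s₂ := μ.cells))
    have h2 := Finset.sum_sdiff_eq_sub (f := w) (Finset.inter_subset_right (s₁ := A) (s₂ := μ.cells))
    rw [Finset.sdiff_inter_self_left] at h1
    rw [Finset.sdiff_inter_self_right] at h2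
    rw [h1, h2, hsum]
  have hneg : ∑ c ∈ μ.cells \ A, w c ≤ 0 := by
    refine Finset.sum_nonpos fun c hc => ?_
    have : (c.1, c.2) ∈ μ := (Finset.mem_sdiff.1 hc).1
    rw [YoungDiagram.mem_iff_lt_rowLen] at this
    simp only [w]
    omega
  by_contra hx
  have hpos : 0 < ∑ c ∈ A \ μ.cells, w c := by
    refine Finset.sum_pos (fun c hc => ?_) ⟨f x, ?_⟩
    · have : (c.1, c.2) ∉ μ := (Finset.mem_sdiff.1 hc).2
      rw [YoungDiagram.mem_iff_lt_rowLen] at this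
      simp only [w]
      omega
    · exact Finset.mem_sdiff.2 ⟨Finset.mem_image_of_mem _ (Finset.mem_univ _), hx⟩
  omega

/-- The combinatorial lemma of von Neumann: either `g` is the product of a row-preserving and a
column-preserving permutation, or two boxes of one row are sent by `g⁻¹` to one column. -/
theorem exists_factorization_or_exists_swap {μ : YoungDiagram} (g : Equiv.Perm (Fin μ.card)) :
    (∃ p q, RowStab μ p ∧ ColStab μ q ∧ g = p * q) ∨
      ∃ u v, u ≠ v ∧ RowStab μ (Equiv.swap u v) ∧ ColStab μ (Equiv.swap (g⁻¹ u) (g⁻¹ v)) := by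
  have hswap : ∀ (F : Fin μ.card → ℕ) (u v : Fin μ.card), F u = F v →
      ∀ x, F (Equiv.swap u v x) = F x := by
    intro F u v h x
    by_cases hu : x = u
    · subst hu; simp [h]
    by_cases hv : x = v
    · subst hv; simp [h]
    rw [Equiv.swap_apply_of_ne_of_ne hu hv]
  by_cases hinj : Function.Injective fun x => (rowOf μ x, colOf μ (g⁻¹ x))
  · left
    let p₀ : Fin μ.card → Fin μ.card := fun x =>
      (fill μ).symm ⟨_, mem_cells_of_injective g⁻¹ hinj x⟩
    have hrow : ∀ x, rowOf μ (p₀ x) = rowOf μ x := fun x => by simp [p₀, rowOf]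
    have hcol : ∀ x, colOf μ (p₀ x) = colOf μ (g⁻¹ x) := fun x => by simp [p₀, colOf]
    have hp : Function.Injective p₀ := fun x y h => hinj <| by
      simp only [Prod.mk.injEq]
      rw [← hrow x, ← hrow y, ← hcol x, ← hcol y, h]
      exact ⟨rfl, rfl⟩
    let p : Equiv.Perm (Fin μ.card) :=
      Equiv.ofBijective p₀ (Finite.injective_iff_bijective.1 hp)
    have hpr : RowStab μ p := hrow
    refine ⟨p⁻¹, p * g, hpr.inv, fun x => ?_, by simp⟩
    have := hcol (g x)
    simpa [p] using this
  · right
    simp only [Function.Injective, not_forall] at hinj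
    obtain ⟨u, v, h, hne⟩ := hinj
    simp only [Prod.mk.injEq] at h
    exact ⟨u, v, hne, hswap _ _ _ h.1, hswap _ _ _ h.2⟩

theorem coeff_youngSymmetrizer (μ : YoungDiagram) (h : Equiv.Perm (Fin μ.card)) :
    (youngSymmetrizer μ).coeff h = ∑ q : Equiv.Perm (Fin μ.card),
      if ColStab μ q ∧ RowStab μ (h * q⁻¹) then ((Equiv.Perm.sign q : ℤ) : ℚ) else 0 := by
  unfold youngSymmetrizer
  rw [Finset.mul_sum, MonoidAlgebra.coeff_sum, Finset.sum_apply']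
  refine Finset.sum_congr rfl fun q _ => ?_
  by_cases hq : ∀ x, colOf μ (q x) = colOf μ x
  · have hq' : ColStab μ q := hq
    rw [if_pos hq, MonoidAlgebra.coeff_mul_single_apply, MonoidAlgebra.coeff_sum,
      Finset.sum_apply', Finset.sum_eq_single (h * q⁻¹)]
    · by_cases hp : ∀ x, rowOf μ ((h * q⁻¹) x) = rowOf μ x
      · have hp' : RowStab μ (h * q⁻¹) := hp
        rw [if_pos hp, if_pos ⟨hq', hp'⟩]
        simp
      · have hp' : ¬ RowStab μ (h * q⁻¹) := hp
        rw [if_neg hp, if_neg fun H => hp' H.2]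
        simp
    · intro p _ hne
      split_ifs
      · simp [hne]
      · simp
    · simp
  · have hq' : ¬ ColStab μ q := hq
    rw [if_neg hq, if_neg fun H => hq' H.1]
    simp

theorem coeff_youngSymmetrizer_one (μ : YoungDiagram) : (youngSymmetrizer μ).coeff 1 = 1 := by
  rw [coeff_youngSymmetrizer, Finset.sum_eq_single 1]
  · rw [if_pos ⟨fun _ => rfl, fun _ => rfl⟩]
    simp
  · intro q _ hq
    rw [if_neg]
    rintro ⟨hc, hr⟩
    apply hq
    rw [one_mul] at hr
    have hr' := hr.inv
    rw [inv_inv] at hr'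
    ext x
    rw [box_injective (hr' x) (hc x)]
    rfl
  · simp

theorem single_mul_youngSymmetrizer {μ : YoungDiagram} {p : Equiv.Perm (Fin μ.card)}
    (hp : RowStab μ p) : MonoidAlgebra.single p (1 : ℚ) * youngSymmetrizer μ =
      youngSymmetrizer μ := by
  ext h
  rw [MonoidAlgebra.coeff_single_mul_apply, coeff_youngSymmetrizer, coeff_youngSymmetrizer, one_mul]
  simp only [mul_assoc, hp.inv.mul_left_iff]

theorem youngSymmetrizer_mul_single {μ : YoungDiagram} {q : Equiv.Perm (Fin μ.card)}
    (hq : ColStab μ q) : youngSymmetrizer μ * MonoidAlgebra.single q (1 : ℚ) =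
      ((Equiv.Perm.sign q : ℤ) : ℚ) • youngSymmetrizer μ := by
  ext h
  rw [MonoidAlgebra.coeff_mul_single_apply, MonoidAlgebra.coeff_smul, Finsupp.smul_apply,
    coeff_youngSymmetrizer, coeff_youngSymmetrizer, mul_one, smul_eq_mul, Finset.mul_sum]
  refine Fintype.sum_equiv (Equiv.mulRight q) _ _ fun r => ?_
  simp only [Equiv.coe_mulRight, hq.mul_right_iff, mul_inv_rev, mul_assoc, mul_ite, mul_zero]
  refine if_congr Iff.rfl ?_ rfl
  rw [Equiv.Perm.sign_mul]
  rcases Int.units_eq_one_or (Equiv.Perm.sign q) with h | h <;> simp [h]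

/-- An element with the symmetries of the Young symmetrizer is a multiple of it. -/
theorem eq_smul_youngSymmetrizer {μ : YoungDiagram}
    {y : MonoidAlgebra ℚ (Equiv.Perm (Fin μ.card))}
    (hrow : ∀ p, RowStab μ p → MonoidAlgebra.single p (1 : ℚ) * y = y)
    (hcol : ∀ q, ColStab μ q → y * MonoidAlgebra.single q (1 : ℚ) =
      ((Equiv.Perm.sign q : ℤ) : ℚ) • y) :
    y = y.coeff 1 • youngSymmetrizer μ := by
  suffices H : ∀ z : MonoidAlgebra ℚ (Equiv.Perm (Fin μ.card)),
      (∀ p, RowStab μ p → MonoidAlgebra.single p (1 : ℚ) * z = z) →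
      (∀ q, ColStab μ q → z * MonoidAlgebra.single q (1 : ℚ) =
        ((Equiv.Perm.sign q : ℤ) : ℚ) • z) → z.coeff 1 = 0 → z = 0 by
    rw [← sub_eq_zero]
    apply H
    · intro p hp
      rw [mul_sub, hrow p hp, mul_smul_comm, single_mul_youngSymmetrizer hp]
    · intro q hq
      rw [sub_mul, hcol q hq, smul_mul_assoc, youngSymmetrizer_mul_single hq, smul_sub,
        smul_comm]
    · simp [coeff_youngSymmetrizer_one]
  intro z hr hc h1
  have hr' : ∀ p g, RowStab μ p → z.coeff (p * g) = z.coeff g := fun p g hp => by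
    conv_lhs => rw [← hr p hp]
    rw [MonoidAlgebra.coeff_single_mul_apply]
    simp
  have hc' : ∀ q g, ColStab μ q → z.coeff (g * q) = (Equiv.Perm.sign q : ℤ) * z.coeff g :=
    fun q g hq => by
      have := congrArg (fun w => w.coeff (g * q)) (hc q hq)
      simp only [MonoidAlgebra.coeff_mul_single_apply, MonoidAlgebra.coeff_smul,
        Finsupp.smul_apply, smul_eq_mul, mul_one, mul_inv_cancel_right] at this
      rw [this, ← mul_assoc]
      rcases Int.units_eq_one_or (Equiv.Perm.sign q) with h | h <;> simp [h]
  ext g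
  rcases exists_factorization_or_exists_swap g with ⟨p, q, hp, hq, rfl⟩ | ⟨u, v, huv, hp, hq⟩
  · have := hc' q 1 hq
    rw [one_mul] at this
    rw [hr' p q hp, this, h1]
    simp
  · have h2 := hr' _ (g * Equiv.swap (g⁻¹ u) (g⁻¹ v)) hp
    rw [hc' _ _ hq, Equiv.Perm.sign_swap (by simpa using huv)] at h2
    have h3 : Equiv.swap u v * (g * Equiv.swap (g⁻¹ u) (g⁻¹ v)) = g := by
      rw [Equiv.swap_apply_apply]
      ext x
      simp
    rw [h3] at h2
    have : z.coeff g = 0 := by push_cast at h2; linarith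
    simpa using this

theorem youngSymmetrizer_mul_self (μ : YoungDiagram) :
    youngSymmetrizer μ * youngSymmetrizer μ =
      (youngSymmetrizer μ * youngSymmetrizer μ).coeff 1 • youngSymmetrizer μ := by
  apply eq_smul_youngSymmetrizer
  · intro p hp
    rw [← mul_assoc, single_mul_youngSymmetrizer hp]
  · intro q hq
    rw [mul_assoc, youngSymmetrizer_mul_single hq, mul_smul_comm]

theorem trace_mulLeft_comp_mulRight {G : Type*} [Group G] [Fintype G] (π : G)
    (y : MonoidAlgebra ℚ G) :
    LinearMap.trace ℚ (MonoidAlgebra ℚ G) (LinearMap.mulLeft ℚ (MonoidAlgebra.single π (1 : ℚ)) ∘ₗ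
      LinearMap.mulRight ℚ y) = ∑ g, y.coeff (g⁻¹ * π⁻¹ * g) := by
  classical
  rw [LinearMap.trace_eq_matrix_trace ℚ (MonoidAlgebra.basis G ℚ), Matrix.trace]
  refine Finset.sum_congr rfl fun g _ => ?_
  rw [Matrix.diag_apply, LinearMap.toMatrix_apply, MonoidAlgebra.basis_apply]
  change (MonoidAlgebra.single π (1 : ℚ) * (MonoidAlgebra.single g 1 * y)).coeff g = _
  simp [mul_assoc]

theorem coeff_youngSymmetrizer_mul_self_ne_zero (μ : YoungDiagram) :
    (youngSymmetrizer μ * youngSymmetrizer μ).coeff 1 ≠ 0 := by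
  intro h
  have hsq := youngSymmetrizer_mul_self μ
  rw [h, zero_smul] at hsq
  have hnil : IsNilpotent (LinearMap.mulRight ℚ (youngSymmetrizer μ)) := by
    refine ⟨2, LinearMap.ext fun x => ?_⟩
    simp [pow_two, mul_assoc, hsq]
  have htr := (LinearMap.isNilpotent_trace_of_isNilpotent hnil).eq_zero
  have := trace_mulLeft_comp_mulRight 1 (youngSymmetrizer μ)
  have hone : LinearMap.mulLeft ℚ (MonoidAlgebra.single (1 : Equiv.Perm (Fin μ.card)) (1 : ℚ)) =
      LinearMap.id := LinearMap.ext fun x => by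
    rw [LinearMap.mulLeft_apply, ← MonoidAlgebra.one_def, one_mul, LinearMap.id_apply]
  rw [hone, LinearMap.id_comp, htr] at this
  simp only [inv_one, mul_one, inv_mul_cancel, coeff_youngSymmetrizer_one, Finset.sum_const,
    nsmul_eq_mul] at this
  exact Fintype.card_ne_zero (by exact_mod_cast this.symm)

theorem irrChar_eq (μ : YoungDiagram) (π : Equiv.Perm (Fin μ.card)) :
    irrChar μ π = ((youngSymmetrizer μ * youngSymmetrizer μ).coeff 1)⁻¹ *
      ∑ g, (youngSymmetrizer μ).coeff (g⁻¹ * π⁻¹ * g) := by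
  set α := (youngSymmetrizer μ * youngSymmetrizer μ).coeff 1 with hα
  have hα0 : α ≠ 0 := coeff_youngSymmetrizer_mul_self_ne_zero μ
  have hsq : youngSymmetrizer μ * youngSymmetrizer μ = α • youngSymmetrizer μ :=
    youngSymmetrizer_mul_self μ
  rw [← trace_mulLeft_comp_mulRight]
  set R := LinearMap.mulRight ℚ (youngSymmetrizer μ) with hR
  set L := LinearMap.mulLeft ℚ (MonoidAlgebra.single π (1 : ℚ)) with hL
  let E : MonoidAlgebra ℚ (Equiv.Perm (Fin μ.card)) →ₗ[ℚ] spechtModule μ :=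
    R.codRestrict (spechtModule μ) fun x => ⟨x, rfl⟩
  have hcomm : L ∘ₗ R =
      ((spechtModule μ).subtype ∘ₗ L.restrict (spechtModule_invariant μ π)) ∘ₗ E :=
    LinearMap.ext fun x => rfl
  have hcomp : E ∘ₗ (spechtModule μ).subtype = α • LinearMap.id := by
    ext1 ⟨x, y, hy⟩
    apply Subtype.ext
    change R x = α • x
    rw [← hy]
    simp only [hR, LinearMap.mulRight_apply]
    rw [mul_assoc, hsq, mul_smul_comm]
  have : LinearMap.trace ℚ (MonoidAlgebra ℚ (Equiv.Perm (Fin μ.card))) (L ∘ₗ R) =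
      α * irrChar μ π := by
    rw [hcomm, LinearMap.trace_comp_comm', ← LinearMap.comp_assoc, hcomp, LinearMap.smul_comp,
      LinearMap.id_comp, map_smul, smul_eq_mul]
    rfl
  rw [this, inv_mul_cancel_left₀ hα0]

/-- The character ratio as an average of coefficients of the Young symmetrizer. -/
theorem irrChar_div_irrChar_one (μ : YoungDiagram) (π : Equiv.Perm (Fin μ.card)) :
    irrChar μ π / irrChar μ 1 =
      (∑ g, (youngSymmetrizer μ).coeff (g⁻¹ * π⁻¹ * g)) / (μ.card.factorial : ℚ) := by
  rw [irrChar_eq, irrChar_eq μ 1,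
    mul_div_mul_left _ _ (inv_ne_zero (coeff_youngSymmetrizer_mul_self_ne_zero μ))]
  simp [coeff_youngSymmetrizer_one, Fintype.card_perm]

/-- A family `f` of boxes is compatible with `(τ, σ)` if the rows are constant along the cycles of
`τ` and the columns are constant along the cycles of `σ`. -/
def Compatible (μ : YoungDiagram) {ι : Type*} (τ σ : Equiv.Perm ι) (f : ι → Fin μ.card) : Prop :=
  (∀ y, rowOf μ (f (τ y)) = rowOf μ (f y)) ∧ ∀ y, colOf μ (f (σ y)) = colOf μ (f y)

noncomputable instance (μ : YoungDiagram) {ι : Type*} [Fintype ι] (τ σ : Equiv.Perm ι) :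
    DecidablePred (Compatible μ τ σ) :=
  fun f => inferInstanceAs (Decidable ((∀ y, rowOf μ (f (τ y)) = rowOf μ (f y)) ∧
    ∀ y, colOf μ (f (σ y)) = colOf μ (f y)))

/-- The number of families of boxes compatible with a pair of permutations. -/
noncomputable def compatibleCount (μ : YoungDiagram) {k : ℕ} (τ σ : Equiv.Perm (Fin k)) : ℕ :=
  (Finset.univ.filter fun f : Fin k → Fin μ.card => Compatible μ τ σ f).card

/-- The signed number of factorizations of `π⁻¹` compatible with the family of boxes `f`. -/
noncomputable def signedCount (μ : YoungDiagram) {ι : Type*} [Fintype ι] [DecidableEq ι] (π : Equiv.Perm ι)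
    (f : ι → Fin μ.card) : ℚ :=
  ∑ σ : Equiv.Perm ι, if Compatible μ (π⁻¹ * σ⁻¹) σ f then ((Equiv.Perm.sign σ : ℤ) : ℚ) else 0

theorem sum_coeff_conj_youngSymmetrizer (μ : YoungDiagram) (π : Equiv.Perm (Fin μ.card)) :
    ∑ g, (youngSymmetrizer μ).coeff (g⁻¹ * π⁻¹ * g) =
      ∑ g : Equiv.Perm (Fin μ.card), signedCount μ π g := by
  refine Fintype.sum_equiv (Equiv.inv _) _ _ fun g => ?_
  rw [coeff_youngSymmetrizer, signedCount]
  refine Fintype.sum_equiv (MulAut.conj g).toEquiv _ _ fun q => ?_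
  simp only [MulEquiv.toEquiv_eq_coe, EquivLike.coe_coe, MulAut.conj_apply, Equiv.inv_apply,
    Equiv.Perm.sign_mul, Equiv.Perm.sign_inv, mul_right_comm, Int.units_mul_self, one_mul]
  refine if_congr ?_ rfl rfl
  rw [and_comm]
  refine and_congr ?_ ?_
  · rw [RowStab, ← Equiv.forall_congr_right (g⁻¹ : Equiv.Perm (Fin μ.card))]
    simp
  · rw [ColStab, ← Equiv.forall_congr_right (g⁻¹ : Equiv.Perm (Fin μ.card))]
    simp

theorem forall_viaEmbedding_iff {α β γ : Type*} (ι : α ↪ β) (σ : Equiv.Perm α) (F : β → γ) :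
    (∀ y, F (σ.viaEmbedding ι y) = F y) ↔ ∀ x, F (ι (σ x)) = F (ι x) := by
  constructor
  · intro h x
    rw [← Equiv.Perm.viaEmbedding_apply]
    exact h _
  · intro h y
    by_cases hy : y ∈ Set.range ι
    · obtain ⟨x, rfl⟩ := hy
      rw [Equiv.Perm.viaEmbedding_apply, h]
    · rw [Equiv.Perm.viaEmbedding_apply_of_notMem _ _ _ hy]

theorem exists_viaEmbedding_eq {α β : Type*} [Finite α] (ι : α ↪ β) (s : Equiv.Perm β)
    (hs : ∀ y ∉ Set.range ι, s y = y) : ∃ σ : Equiv.Perm α, σ.viaEmbedding ι = s := by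
  have h : ∀ x, ∃ y, ι y = s (ι x) := by
    intro x
    by_contra hx
    exact hx ⟨x, (s.injective (hs _ hx)).symm⟩
  choose σ₀ hσ using h
  have hinj : Function.Injective σ₀ := fun x y hxy =>
    ι.injective (s.injective (by rw [← hσ, ← hσ, hxy]))
  refine ⟨Equiv.ofBijective σ₀ (Finite.injective_iff_bijective.1 hinj), Equiv.ext fun y => ?_⟩
  by_cases hy : y ∈ Set.range ι
  · obtain ⟨x, rfl⟩ := hy
    rw [Equiv.Perm.viaEmbedding_apply]
    exact hσ x
  · rw [Equiv.Perm.viaEmbedding_apply_of_notMem _ _ _ hy, hs y hy]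

theorem signedCount_viaEmbedding {μ : YoungDiagram} {k : ℕ} (ι : Fin k ↪ Fin μ.card)
    (π : Equiv.Perm (Fin k)) (g : Equiv.Perm (Fin μ.card)) :
    signedCount μ (π.viaEmbedding ι) g = signedCount μ π (g ∘ ι) := by
  symm
  refine Finset.sum_of_injOn (fun σ => σ.viaEmbedding ι)
    (fun _ _ _ _ h => Equiv.Perm.viaEmbeddingHom_injective ι h) (fun _ _ => by simp) ?_ ?_
  · intro s _ hs
    rw [if_neg]
    rintro ⟨hr, hc⟩
    apply hs
    obtain ⟨σ, hσ⟩ := exists_viaEmbedding_eq ι s fun y hy => by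
      have h1 := hr (s y)
      have h2 : (π.viaEmbedding ι)⁻¹ y = y := by
        rw [Equiv.Perm.inv_eq_iff_eq, Equiv.Perm.viaEmbedding_apply_of_notMem _ _ _ hy]
      rw [Equiv.Perm.mul_apply, ← Equiv.Perm.mul_apply s⁻¹, inv_mul_cancel, Equiv.Perm.one_apply,
        h2] at h1
      exact g.injective (box_injective h1.symm (hc y))
    exact ⟨σ, by simp, hσ⟩
  · intro σ _
    have hmul : (π.viaEmbedding ι)⁻¹ * (σ.viaEmbedding ι)⁻¹ =
        (π⁻¹ * σ⁻¹).viaEmbedding ι := by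
      simp only [← Equiv.Perm.viaEmbeddingHom_apply, map_mul, map_inv]
    have hsign : Equiv.Perm.sign (σ.viaEmbedding ι) = Equiv.Perm.sign σ := by
      convert Equiv.Perm.sign_extendDomain σ (Equiv.ofInjective ι ι.injective)
      rw [Equiv.Perm.viaEmbedding]
      congr!
    rw [hsign]
    refine if_congr ?_ rfl rfl
    rw [hmul]
    exact and_congr
      (forall_viaEmbedding_iff ι (π⁻¹ * σ⁻¹) fun y => rowOf μ (g y)).symm
      (forall_viaEmbedding_iff ι σ fun y => colOf μ (g y)).symm

theorem exists_perm_comp_embedding {α β : Type*} [Finite β] (ι f : α ↪ β) :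
    ∃ g : Equiv.Perm β, ⇑g ∘ ι = f := by
  classical
  have := Fintype.ofFinite β
  let e : Set.range ι ≃ Set.range f :=
    (Equiv.ofInjective ι ι.injective).symm.trans (Equiv.ofInjective f f.injective)
  refine ⟨e.extendSubtype, funext fun x => ?_⟩
  rw [Function.comp_apply, Equiv.extendSubtype_apply_of_mem e (ι x) ⟨x, rfl⟩]
  simp [e]

/-- Averaging over permutations amounts to averaging over embeddings. -/
theorem descFactorial_mul_sum_perm_comp {k n : ℕ} (ι : Fin k ↪ Fin n)
    (Φ : (Fin k → Fin n) → ℚ) :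
    (n.descFactorial k : ℚ) * ∑ g : Equiv.Perm (Fin n), Φ (g ∘ ι) =
      n.factorial * ∑ f : Fin k ↪ Fin n, Φ f := by
  have h1 : ∀ f : Fin k ↪ Fin n, ∑ g : Equiv.Perm (Fin n), Φ (g ∘ f) =
      ∑ g : Equiv.Perm (Fin n), Φ (g ∘ ι) := by
    intro f
    obtain ⟨h, hh⟩ := exists_perm_comp_embedding ι f
    refine Fintype.sum_equiv (Equiv.mulRight h) _ _ fun g => ?_
    rw [← hh]
    rfl
  have h2 : ∀ g : Equiv.Perm (Fin n), ∑ f : Fin k ↪ Fin n, Φ (g ∘ f) =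
      ∑ f : Fin k ↪ Fin n, Φ f := by
    intro g
    exact Fintype.sum_equiv (Equiv.embeddingCongr (Equiv.refl _) g) _ _ fun f => rfl
  have h3 : ∑ f : Fin k ↪ Fin n, ∑ g : Equiv.Perm (Fin n), Φ (g ∘ f) =
      ∑ g : Equiv.Perm (Fin n), ∑ f : Fin k ↪ Fin n, Φ (g ∘ f) := Finset.sum_comm
  simp only [h1, h2, Finset.sum_const, Finset.card_univ, Fintype.card_embedding_eq,
    Fintype.card_perm, Fintype.card_fin, nsmul_eq_mul] at h3
  exact h3

theorem signedCount_eq_zero {μ : YoungDiagram} {ι : Type*} [Fintype ι] [DecidableEq ι] (π : Equiv.Perm ι)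
    {f : ι → Fin μ.card} (hf : ¬ Function.Injective f) : signedCount μ π f = 0 := by
  simp only [Function.Injective, not_forall] at hf
  obtain ⟨a, b, hab, hne⟩ := hf
  have hswap : ∀ x, f (Equiv.swap a b x) = f x := by
    intro x
    by_cases ha : x = a
    · subst ha; simp [hab]
    by_cases hb : x = b
    · subst hb; simp [hab]
    rw [Equiv.swap_apply_of_ne_of_ne ha hb]
  have key : signedCount μ π f = - signedCount μ π f := by
    conv_rhs => rw [signedCount, ← Finset.sum_neg_distrib]
    refine Fintype.sum_equiv (Equiv.mulLeft (Equiv.swap a b)) _ _ fun σ => ?_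
    simp only [Equiv.coe_mulLeft, Equiv.Perm.sign_mul, Equiv.Perm.sign_swap hne]
    have hiff : Compatible μ (π⁻¹ * σ⁻¹) σ f ↔
        Compatible μ (π⁻¹ * (Equiv.swap a b * σ)⁻¹) (Equiv.swap a b * σ) f := by
      refine and_congr ?_ ?_
      · rw [← Equiv.forall_congr_right (Equiv.swap a b)]
        simp [hswap]
      · simp [hswap]
    rw [if_congr hiff rfl rfl]
    split_ifs <;> simp
  linarith

/-- The Stanley-Féray character formula. -/
theorem normChar_eq_sum_compatibleCount {k : ℕ} (μ : YoungDiagram) (π : Equiv.Perm (Fin k)) :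
    normChar μ π = ∑ σ : Equiv.Perm (Fin k),
      ((Equiv.Perm.sign σ : ℤ) : ℚ) * compatibleCount μ (π⁻¹ * σ⁻¹) σ := by
  have hall : ∑ σ : Equiv.Perm (Fin k),
      ((Equiv.Perm.sign σ : ℤ) : ℚ) * compatibleCount μ (π⁻¹ * σ⁻¹) σ =
      ∑ f : Fin k ↪ Fin μ.card, signedCount μ π f := by
    have : ∑ f : Fin k → Fin μ.card, signedCount μ π f =
        ∑ f : Fin k ↪ Fin μ.card, signedCount μ π f := by
      symm
      refine Finset.sum_of_injOn (fun f : Fin k ↪ Fin μ.card => (f : Fin k → Fin μ.card))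
        (fun _ _ _ _ h => DFunLike.coe_injective h) (fun _ _ => by simp) ?_ fun _ _ => rfl
      intro f _ hf
      refine signedCount_eq_zero π fun hinj => hf ⟨⟨f, hinj⟩, by simp, rfl⟩
    rw [← this]
    simp only [signedCount]
    rw [Finset.sum_comm]
    refine Finset.sum_congr rfl fun σ _ => ?_
    rw [← Finset.sum_filter, Finset.sum_const, nsmul_eq_mul, mul_comm, compatibleCount]
  rw [hall, normChar]
  split_ifs with h
  · rw [mul_div_assoc, irrChar_div_irrChar_one, sum_coeff_conj_youngSymmetrizer]
    simp only [signedCount_viaEmbedding]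
    rw [← mul_div_assoc, descFactorial_mul_sum_perm_comp]
    exact mul_div_cancel_left₀ _ (by exact_mod_cast Nat.factorial_ne_zero _)
  · have : IsEmpty (Fin k ↪ Fin μ.card) := ⟨fun f => h <| by
      simpa using Fintype.card_le_of_embedding f⟩
    simp

theorem mem_dilate {μ : YoungDiagram} {s : ℕ} (hs : 0 < s) {c : ℕ × ℕ} :
    c ∈ (dilate μ s).cells ↔ (c.1 / s, c.2 / s) ∈ μ.cells := by
  simp only [dilate, Finset.mem_filter, Finset.mem_product, Finset.mem_range, and_iff_right_iff_imp]
  intro h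
  have h1 : (c.1 / s, 0) ∈ μ := μ.up_left_mem le_rfl (Nat.zero_le _) h
  have h2 : (0, c.2 / s) ∈ μ := μ.up_left_mem (Nat.zero_le _) le_rfl h
  rw [YoungDiagram.mem_iff_lt_colLen, Nat.div_lt_iff_lt_mul hs] at h1
  rw [YoungDiagram.mem_iff_lt_rowLen, Nat.div_lt_iff_lt_mul hs] at h2
  exact ⟨by rwa [mul_comm], by rwa [mul_comm]⟩

/-- A box of the dilated diagram is a box of `μ` together with a position in an `s × s` grid. -/
def dilateCellsEquiv (μ : YoungDiagram) {s : ℕ} (hs : 0 < s) :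
    {c // c ∈ (dilate μ s).cells} ≃ {c // c ∈ μ.cells} × Fin s × Fin s where
  toFun c := (⟨(c.1.1 / s, c.1.2 / s), (mem_dilate hs).1 c.2⟩,
    ⟨c.1.1 % s, Nat.mod_lt _ hs⟩, ⟨c.1.2 % s, Nat.mod_lt _ hs⟩)
  invFun d := ⟨(s * d.1.1.1 + d.2.1, s * d.1.1.2 + d.2.2), (mem_dilate hs).2 <| by
    simp [Nat.mul_add_div hs, Nat.div_eq_of_lt d.2.1.2, Nat.div_eq_of_lt d.2.2.2]⟩
  left_inv c := by simp [Nat.div_add_mod]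
  right_inv d := by
    simp [Nat.mul_add_div hs, Nat.div_eq_of_lt, Nat.mod_eq_of_lt]

/-- `dilateCellsEquiv` transported along the canonical fillings. -/
noncomputable def dilateEquiv (μ : YoungDiagram) {s : ℕ} (hs : 0 < s) :
    Fin (dilate μ s).card ≃ Fin μ.card × Fin s × Fin s :=
  (fill _).trans ((dilateCellsEquiv μ hs).trans (Equiv.prodCongr (fill μ).symm (Equiv.refl _)))

theorem rowOf_dilate_eq_iff {μ : YoungDiagram} {s : ℕ} (hs : 0 < s)
    (x y : Fin (dilate μ s).card) : rowOf _ x = rowOf _ y ↔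
      rowOf μ (dilateEquiv μ hs x).1 = rowOf μ (dilateEquiv μ hs y).1 ∧
        (dilateEquiv μ hs x).2.1 = (dilateEquiv μ hs y).2.1 := by
  simp only [rowOf, dilateEquiv, dilateCellsEquiv, Equiv.trans_apply, Equiv.coe_fn_mk,
    Equiv.prodCongr_apply, Prod.map_fst, Prod.map_snd, Equiv.apply_symm_apply, Equiv.refl_apply,
    Fin.mk.injEq]
  exact ⟨fun h => by rw [h]; exact ⟨rfl, rfl⟩, fun h => Nat.ext_div_mod h.1 h.2⟩

theorem colOf_dilate_eq_iff {μ : YoungDiagram} {s : ℕ} (hs : 0 < s)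
    (x y : Fin (dilate μ s).card) : colOf _ x = colOf _ y ↔
      colOf μ (dilateEquiv μ hs x).1 = colOf μ (dilateEquiv μ hs y).1 ∧
        (dilateEquiv μ hs x).2.2 = (dilateEquiv μ hs y).2.2 := by
  simp only [colOf, dilateEquiv, dilateCellsEquiv, Equiv.trans_apply, Equiv.coe_fn_mk,
    Equiv.prodCongr_apply, Prod.map_fst, Prod.map_snd, Equiv.apply_symm_apply, Equiv.refl_apply,
    Fin.mk.injEq]
  exact ⟨fun h => by rw [h]; exact ⟨rfl, rfl⟩, fun h => Nat.ext_div_mod h.1 h.2⟩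

/-- The number of cycles of a permutation, fixed points included. -/
def orbitCount {k : ℕ} (σ : Equiv.Perm (Fin k)) : ℕ :=
  @Fintype.card (Quotient (Equiv.Perm.SameCycle.setoid σ))
    (@Quotient.fintype _ _ (Equiv.Perm.SameCycle.setoid σ)
      (inferInstanceAs (DecidableRel σ.SameCycle)))

theorem eq_of_sameCycle {α β : Type*} {σ : Equiv.Perm α} {r : α → β}
    (hr : ∀ y, r (σ y) = r y) {x y : α} (h : σ.SameCycle x y) : r x = r y := by
  obtain ⟨i, rfl⟩ := h
  have hinv : ∀ y, r (σ⁻¹ y) = r y := fun y => by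
    rw [← hr (σ⁻¹ y), ← Equiv.Perm.mul_apply, mul_inv_cancel, Equiv.Perm.one_apply]
  induction i with
  | zero => simp
  | succ i ih => rw [add_comm, zpow_add, zpow_one, Equiv.Perm.mul_apply, hr, ih]
  | pred i ih => rw [sub_eq_neg_add, zpow_add, zpow_neg_one, Equiv.Perm.mul_apply, hinv, ih]

theorem card_invariant_functions {k : ℕ} (σ : Equiv.Perm (Fin k)) (s : ℕ) :
    Nat.card {r : Fin k → Fin s // ∀ y, r (σ y) = r y} = s ^ orbitCount σ := by
  let S := Equiv.Perm.SameCycle.setoid σ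
  have e : {r : Fin k → Fin s // ∀ y, r (σ y) = r y} ≃ (Quotient S → Fin s) :=
    { toFun := fun r => Quotient.lift r.1 fun _ _ h => eq_of_sameCycle r.2 h
      invFun := fun F => ⟨fun x => F ⟦x⟧, fun y => congrArg F (Quotient.sound
        (Equiv.Perm.sameCycle_apply_left.2 (Equiv.Perm.SameCycle.refl σ y)))⟩
      left_inv := fun r => rfl
      right_inv := fun F => funext fun q => Quotient.inductionOn q fun _ => rfl }
  rw [Nat.card_congr e, Nat.card_fun, Nat.card_fin, orbitCount]
  exact congrArg _ (@Nat.card_eq_fintype_card _ (_))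

theorem compatibleCount_eq_card (μ : YoungDiagram) {k : ℕ} (τ σ : Equiv.Perm (Fin k)) :
    compatibleCount μ τ σ = Nat.card {f : Fin k → Fin μ.card // Compatible μ τ σ f} := by
  rw [Nat.card_eq_fintype_card, Fintype.card_subtype, compatibleCount]

theorem compatibleCount_dilate (μ : YoungDiagram) {s : ℕ} (hs : 0 < s) {k : ℕ}
    (τ σ : Equiv.Perm (Fin k)) :
    compatibleCount (dilate μ s) τ σ =
      compatibleCount μ τ σ * s ^ (orbitCount τ + orbitCount σ) := by
  have e : {f : Fin k → Fin (dilate μ s).card // Compatible (dilate μ s) τ σ f} ≃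
      {f : Fin k → Fin μ.card // Compatible μ τ σ f} ×
        {r : Fin k → Fin s // ∀ y, r (τ y) = r y} × {r : Fin k → Fin s // ∀ y, r (σ y) = r y} :=
    { toFun := fun f =>
        (⟨fun x => (dilateEquiv μ hs (f.1 x)).1,
            fun y => ((rowOf_dilate_eq_iff hs _ _).1 (f.2.1 y)).1,
            fun y => ((colOf_dilate_eq_iff hs _ _).1 (f.2.2 y)).1⟩,
          ⟨fun x => (dilateEquiv μ hs (f.1 x)).2.1,
            fun y => ((rowOf_dilate_eq_iff hs _ _).1 (f.2.1 y)).2⟩,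
          ⟨fun x => (dilateEquiv μ hs (f.1 x)).2.2,
            fun y => ((colOf_dilate_eq_iff hs _ _).1 (f.2.2 y)).2⟩)
      invFun := fun g =>
        ⟨fun x => (dilateEquiv μ hs).symm (g.1.1 x, g.2.1.1 x, g.2.2.1 x),
          fun y => (rowOf_dilate_eq_iff hs _ _).2 <| by
            simpa using ⟨g.1.2.1 y, g.2.1.2 y⟩,
          fun y => (colOf_dilate_eq_iff hs _ _).2 <| by
            simpa using ⟨g.1.2.2 y, g.2.2.2 y⟩⟩
      left_inv := fun f => by simp
      right_inv := fun g => by simp }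
  rw [compatibleCount_eq_card, compatibleCount_eq_card, Nat.card_congr e, Nat.card_prod,
    Nat.card_prod, card_invariant_functions, card_invariant_functions, pow_add]

theorem freeCumulant_succ_eq_sum (μ : YoungDiagram) (k : ℕ) :
    freeCumulant μ (k + 1) = ∑ σ : Equiv.Perm (Fin k),
      if orbitCount ((finRotate k)⁻¹ * σ⁻¹) + orbitCount σ = k + 1 then
        ((Equiv.Perm.sign σ : ℤ) : ℚ) * compatibleCount μ ((finRotate k)⁻¹ * σ⁻¹) σ else 0 := by
  let P : Polynomial ℚ := ∑ σ : Equiv.Perm (Fin k), Polynomial.monomial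
    (orbitCount ((finRotate k)⁻¹ * σ⁻¹) + orbitCount σ)
    (((Equiv.Perm.sign σ : ℤ) : ℚ) * compatibleCount μ ((finRotate k)⁻¹ * σ⁻¹) σ)
  have hP : ∀ s : ℕ, 0 < s → SigmaCycle (dilate μ s) (k + 1 - 1) = P.eval (s : ℚ) := by
    intro s hs
    rw [Nat.add_sub_cancel, SigmaCycle, normChar_eq_sum_compatibleCount, Polynomial.eval_finsetSum]
    refine Finset.sum_congr rfl fun σ _ => ?_
    rw [compatibleCount_dilate μ hs, Polynomial.eval_monomial]
    push_cast
    ring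
  have hex : ∃ p : Polynomial ℚ, ∀ s : ℕ, 0 < s →
      SigmaCycle (dilate μ s) (k + 1 - 1) = Polynomial.eval (s : ℚ) p := ⟨P, hP⟩
  have huniq : hex.choose = P := by
    refine Polynomial.eq_of_infinite_eval_eq _ _ (Set.Infinite.mono (s := Set.range
      fun n : ℕ => ((n + 1 : ℕ) : ℚ)) ?_ (Set.infinite_range_of_injective fun a b h => ?_))
    · rintro _ ⟨n, rfl⟩
      exact (hex.choose_spec _ n.succ_pos).symm.trans (hP _ n.succ_pos)
    · simpa using h
  rw [freeCumulant, dif_pos hex, huniq, Polynomial.finsetSum_coeff]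
  simp only [Polynomial.coeff_monomial]

/-- `τ` is a single cycle and `σ` has exactly two cycles. -/
def IsOneTwo {k : ℕ} (τ σ : Equiv.Perm (Fin k)) : Prop :=
  (∀ x y, τ.SameCycle x y) ∧
    ∃ a b, ¬ σ.SameCycle a b ∧ ∀ x, σ.SameCycle a x ∨ σ.SameCycle b x

instance {k : ℕ} (τ σ : Equiv.Perm (Fin k)) : Decidable (IsOneTwo τ σ) :=
  inferInstanceAs (Decidable ((∀ x y, τ.SameCycle x y) ∧
    ∃ a b, ¬ σ.SameCycle a b ∧ ∀ x, σ.SameCycle a x ∨ σ.SameCycle b x))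

theorem IsOneTwo.card_eq {k n : ℕ} {τ σ : Equiv.Perm (Fin k)} (h : IsOneTwo τ σ)
    {F G : Fin n → ℕ} (hFG : ∀ x y, F x = F y → G x = G y → x = y) :
    (Finset.univ.filter fun f : Fin k → Fin n =>
      (∀ y, F (f (τ y)) = F (f y)) ∧ ∀ y, G (f (σ y)) = G (f y)).card =
    (Finset.univ.filter fun p : Fin n × Fin n => F p.1 = F p.2).card := by
  obtain ⟨hτ, a, b, hab, hσ⟩ := h
  refine Finset.card_bij (fun f _ => (f a, f b)) ?_ ?_ ?_
  · intro f hf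
    simp only [Finset.mem_filter, Finset.mem_univ, true_and] at hf ⊢
    exact eq_of_sameCycle (r := fun x => F (f x)) hf.1 (hτ a b)
  · intro f hf g hg hfg
    simp only [Finset.mem_filter, Finset.mem_univ, true_and, Prod.mk.injEq] at hf hg hfg
    funext x
    apply hFG
    · have h1 := eq_of_sameCycle (r := fun x => F (f x)) hf.1 (hτ a x)
      have h2 := eq_of_sameCycle (r := fun x => F (g x)) hg.1 (hτ a x)
      rw [← h1, ← h2, hfg.1]
    · rcases hσ x with hx | hx
      all_goals
        have h1 := eq_of_sameCycle (r := fun x => G (f x)) hf.2 hx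
        have h2 := eq_of_sameCycle (r := fun x => G (g x)) hg.2 hx
        rw [← h1, ← h2]
        simp [hfg]
  · rintro ⟨p, q⟩ hpq
    simp only [Finset.mem_filter, Finset.mem_univ, true_and] at hpq
    refine ⟨fun x => if σ.SameCycle a x then p else q, ?_, ?_⟩
    · simp only [Finset.mem_filter, Finset.mem_univ, true_and, Equiv.Perm.sameCycle_apply_right,
        implies_true, and_true]
      intro y
      split_ifs <;> simp [hpq]
    · simp [hab, Equiv.Perm.SameCycle.refl]

/-- The number of ordered pairs of boxes in the same row. -/
noncomputable def rowPairs (μ : YoungDiagram) : ℕ :=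
  (Finset.univ.filter fun p : Fin μ.card × Fin μ.card => rowOf μ p.1 = rowOf μ p.2).card

/-- The number of ordered pairs of boxes in the same column. -/
noncomputable def colPairs (μ : YoungDiagram) : ℕ :=
  (Finset.univ.filter fun p : Fin μ.card × Fin μ.card => colOf μ p.1 = colOf μ p.2).card

theorem IsOneTwo.compatibleCount_eq_rowPairs {k : ℕ} {τ σ : Equiv.Perm (Fin k)}
    (h : IsOneTwo τ σ) (μ : YoungDiagram) : compatibleCount μ τ σ = rowPairs μ := by
  rw [rowPairs, ← h.card_eq fun _ _ hr hc => box_injective hr hc, compatibleCount]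
  exact congrArg Finset.card (Finset.filter_congr fun f _ => Iff.rfl)

theorem IsOneTwo.compatibleCount_eq_colPairs {k : ℕ} {τ σ : Equiv.Perm (Fin k)}
    (h : IsOneTwo σ τ) (μ : YoungDiagram) : compatibleCount μ τ σ = colPairs μ := by
  rw [colPairs, ← h.card_eq fun _ _ hc hr => box_injective hr hc, compatibleCount]
  exact congrArg Finset.card (Finset.filter_congr fun f _ => and_comm)

/-- A signed sum over factorizations each of which has one cycle on one side and two cycles on
the other side. -/
theorem sum_sign_mul_compatibleCount (μ : YoungDiagram) {k : ℕ} (π : Equiv.Perm (Fin k))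
    (S : Finset (Equiv.Perm (Fin k)))
    (hS : ∀ σ ∈ S, IsOneTwo (π⁻¹ * σ⁻¹) σ ∨ IsOneTwo σ (π⁻¹ * σ⁻¹)) :
    ∑ σ ∈ S, ((Equiv.Perm.sign σ : ℤ) : ℚ) * compatibleCount μ (π⁻¹ * σ⁻¹) σ =
      ((∑ σ ∈ S with IsOneTwo (π⁻¹ * σ⁻¹) σ, (Equiv.Perm.sign σ : ℤ) : ℤ) : ℚ) * rowPairs μ +
      ((∑ σ ∈ S with ¬ IsOneTwo (π⁻¹ * σ⁻¹) σ, (Equiv.Perm.sign σ : ℤ) : ℤ) : ℚ) * colPairs μ := by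
  rw [← Finset.sum_filter_add_sum_filter_not S fun σ => IsOneTwo (π⁻¹ * σ⁻¹) σ]
  push_cast
  rw [Finset.sum_mul, Finset.sum_mul]
  congr 1
  · refine Finset.sum_congr rfl fun σ hσ => ?_
    rw [(Finset.mem_filter.1 hσ).2.compatibleCount_eq_rowPairs]
  · refine Finset.sum_congr rfl fun σ hσ => ?_
    obtain ⟨h1, h2⟩ := Finset.mem_filter.1 hσ
    rw [((hS σ h1).resolve_left h2).compatibleCount_eq_colPairs]

theorem freeCumulant_three (μ : YoungDiagram) :
    freeCumulant μ 3 = (rowPairs μ : ℚ) - colPairs μ := by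
  rw [freeCumulant_succ_eq_sum μ 2, ← Finset.sum_filter,
    sum_sign_mul_compatibleCount μ (finRotate 2) _ (by decide +kernel)]
  have h1 : ∑ σ ∈ Finset.univ.filter (fun σ : Equiv.Perm (Fin 2) =>
      orbitCount ((finRotate 2)⁻¹ * σ⁻¹) + orbitCount σ = 2 + 1) with
      IsOneTwo ((finRotate 2)⁻¹ * σ⁻¹) σ, (Equiv.Perm.sign σ : ℤ) = 1 := by decide +kernel
  have h2 : ∑ σ ∈ Finset.univ.filter (fun σ : Equiv.Perm (Fin 2) =>
      orbitCount ((finRotate 2)⁻¹ * σ⁻¹) + orbitCount σ = 2 + 1) with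
      ¬ IsOneTwo ((finRotate 2)⁻¹ * σ⁻¹) σ, (Equiv.Perm.sign σ : ℤ) = -1 := by decide +kernel
  rw [h1, h2]
  push_cast
  ring

/-- For every Young diagram `μ`, `Σ_4^μ = R_5^μ + 5·R_3^μ`
(the Kerov polynomial `K_4` is `R_5 + 5R_3`). -/
theorem kerov_K4 (μ : YoungDiagram) :
    SigmaCycle μ 4 = freeCumulant μ 5 + 5 * freeCumulant μ 3 := by
  rw [SigmaCycle, normChar_eq_sum_compatibleCount, freeCumulant_succ_eq_sum μ 4,
    ← Finset.sum_filter, freeCumulant_three, ← Finset.sum_filter_add_sum_filter_not Finset.univ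
      fun σ : Equiv.Perm (Fin 4) => orbitCount ((finRotate 4)⁻¹ * σ⁻¹) + orbitCount σ = 4 + 1,
    sum_sign_mul_compatibleCount μ (finRotate 4)
      (Finset.univ.filter fun σ => ¬ orbitCount ((finRotate 4)⁻¹ * σ⁻¹) + orbitCount σ = 4 + 1)
      (by decide +kernel)]
  have h1 : ∑ σ ∈ Finset.univ.filter (fun σ : Equiv.Perm (Fin 4) =>
      ¬ orbitCount ((finRotate 4)⁻¹ * σ⁻¹) + orbitCount σ = 4 + 1) with
      IsOneTwo ((finRotate 4)⁻¹ * σ⁻¹) σ, (Equiv.Perm.sign σ : ℤ) = 5 := by decide +kernel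
  have h2 : ∑ σ ∈ Finset.univ.filter (fun σ : Equiv.Perm (Fin 4) =>
      ¬ orbitCount ((finRotate 4)⁻¹ * σ⁻¹) + orbitCount σ = 4 + 1) with
      ¬ IsOneTwo ((finRotate 4)⁻¹ * σ⁻¹) σ, (Equiv.Perm.sign σ : ℤ) = -5 := by decide +kernel
  rw [h1, h2]
  push_cast
  ring

end AsympRep
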